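/- Let c(n) denote the number of triples (λ, μ, ν), where λ is a partition with no part divisible by 3 and no part divisible by 5, μ is a partition into distinct parts all divisible by 3, ν is a partition into distinct parts all divisible by 5, and |λ| + |μ| + |ν| = n. Then for every natural number n, c(2n) = Σ_{i=0}^{n} c(i) · c(n − i); that is, the sequence (c(n)) is 2-convolutive. -/

import Mathlib

open PowerSeries PowerSeries.WithPiTopology Filter Finset

/-- The generating function counting the elements of `α` by their weight. -/
noncomputable def weightSeries {α : Type*} (w : α → ℕ) : ℚ⟦X⟧ :=
  PowerSeries.mk fun n ↦ (Nat.card {a // w a = n} : ℚ)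

theorem weightSeries_comp_equiv {α β : Type*} (e : α ≃ β) (w : β → ℕ) :
    weightSeries (fun a ↦ w (e a)) = weightSeries w := by
  ext n
  simp only [weightSeries, coeff_mk]
  exact congrArg _ (Nat.card_congr (e.subtypeEquiv fun _ ↦ Iff.rfl))

theorem weightSeries_mul {α β : Type*} (v : α → ℕ) (w : β → ℕ)
    (hv : ∀ n, Finite {a // v a = n}) (hw : ∀ n, Finite {b // w b = n}) :
    weightSeries v * weightSeries w = weightSeries fun p : α × β ↦ v p.1 + w p.2 := by
  ext n
  simp only [weightSeries, coeff_mul, coeff_mk]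
  let e : {p : α × β // v p.1 + w p.2 = n} ≃
      Σ x : antidiagonal n, {a // v a = x.1.1} × {b // w b = x.1.2} :=
    { toFun := fun p ↦ ⟨⟨(v p.1.1, w p.1.2), by simpa using p.2⟩, ⟨p.1.1, rfl⟩, ⟨p.1.2, rfl⟩⟩
      invFun := fun s ↦ ⟨(s.2.1.1, s.2.2.1), by
        rw [s.2.1.2, s.2.2.2]; exact mem_antidiagonal.mp s.1.2⟩
      left_inv := fun _ ↦ rfl
      right_inv := by
        rintro ⟨⟨⟨i, j⟩, h⟩, ⟨a, ha⟩, ⟨b, hb⟩⟩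
        dsimp only at ha hb
        subst ha hb
        rfl }
  rw [Nat.card_congr e, Nat.card_sigma]
  simp_rw [Nat.card_prod]
  push_cast
  exact (sum_coe_sort (antidiagonal n) fun x ↦
    (Nat.card {a // v a = x.1} : ℚ) * Nat.card {b // w b = x.2}).symm

theorem finite_add_fiber {α β : Type*} (v : α → ℕ) (w : β → ℕ)
    (hv : ∀ n, Finite {a // v a = n}) (hw : ∀ n, Finite {b // w b = n}) (n : ℕ) :
    Finite {p : α × β // v p.1 + w p.2 = n} := by
  have hv' : {a | v a ≤ n}.Finite := by
    have : {a | v a ≤ n} = ⋃ i ∈ Set.Iic n, {a | v a = i} := by ext; simp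
    rw [this]
    exact (Set.finite_Iic n).biUnion fun i _ ↦ hv i
  have hw' : {b | w b ≤ n}.Finite := by
    have : {b | w b ≤ n} = ⋃ i ∈ Set.Iic n, {b | w b = i} := by ext; simp
    rw [this]
    exact (Set.finite_Iic n).biUnion fun i _ ↦ hw i
  refine ((hv'.prod hw').subset ?_ : {p : α × β | v p.1 + w p.2 = n}.Finite)
  rintro ⟨a, b⟩ h
  simp only [Set.mem_ofPred_eq, Set.mem_prod] at h ⊢
  omega

theorem finite_mul_fiber {α : Type*} {k : ℕ} (hk : k ≠ 0) (w : α → ℕ)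
    (hw : ∀ n, Finite {a // w a = n}) (n : ℕ) : Finite {a // k * w a = n} := by
  have h : {a | w a = n / k}.Finite := hw _
  refine (h.subset ?_ : {a | k * w a = n}.Finite)
  rintro a rfl
  simp [Nat.mul_div_cancel_left _ (Nat.pos_of_ne_zero hk)]

theorem expand_weightSeries {α : Type*} {k : ℕ} (hk : k ≠ 0) (w : α → ℕ) :
    expand k hk (weightSeries w) = weightSeries fun a ↦ k * w a := by
  ext n
  rw [coeff_expand]
  simp only [weightSeries, coeff_mk]
  split_ifs with h
  · obtain ⟨m, rfl⟩ := h
    simp [Nat.mul_div_cancel_left _ (Nat.pos_of_ne_zero hk), hk]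
  · have : IsEmpty {a // k * w a = n} := ⟨fun a ↦ h ⟨_, a.2.symm⟩⟩
    simp

theorem weightSeries_multiset (Q : ℕ → ℕ → Prop) [∀ i c, Decidable (Q i c)] :
    weightSeries (fun m : {m : Multiset ℕ // ∀ i ∈ m, 0 < i ∧ Q i (m.count i)} ↦ m.1.sum) =
      Nat.Partition.genFun fun i c ↦ if Q i c then (1 : ℚ) else 0 := by
  ext n
  simp only [weightSeries, coeff_mk, Nat.Partition.coeff_genFun, Finsupp.prod, prod_boole]
  rw [sum_boole, ← Fintype.card_subtype, ← Nat.card_eq_fintype_card]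
  refine congrArg _ (Nat.card_congr ?_)
  exact
    { toFun := fun m ↦ ⟨⟨m.1.1, fun hi ↦ (m.1.2 _ hi).1, m.2⟩, fun i hi ↦
        (m.1.2 i (by simpa using hi)).2⟩
      invFun := fun p ↦ ⟨⟨p.1.parts, fun i hi ↦ ⟨p.1.parts_pos hi, p.2 i (by simpa using hi)⟩⟩,
        p.1.parts_sum⟩
      left_inv := fun _ ↦ rfl
      right_inv := fun _ ↦ rfl }

theorem finite_multiset_fiber (P : Multiset ℕ → Prop) (hP : ∀ m, P m → ∀ i ∈ m, 0 < i) (n : ℕ) :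
    Finite {m : {m : Multiset ℕ // P m} // m.1.sum = n} :=
  Finite.of_injective
    (β := n.Partition) (fun m ↦ ⟨m.1.1, fun hi ↦ hP _ m.1.2 _ hi, m.2⟩)
    fun _ _ h ↦ Subtype.ext (Subtype.ext (congrArg Nat.Partition.parts h))

theorem continuous_expand {k : ℕ} (hk : k ≠ 0) :
    Continuous (expand k hk : ℚ⟦X⟧ →ₐ[ℚ] ℚ⟦X⟧) := by
  rw [continuous_iff_continuousAt]
  intro f
  rw [ContinuousAt, tendsto_iff_coeff_tendsto]
  intro d
  simp only [coeff_expand]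
  split_ifs
  · exact (continuous_coeff (R := ℚ) (d / k)).tendsto f
  · exact tendsto_const_nhds

/-- Euler's product `∏ (1 - X ^ n)` over the positive integers `n`. -/
noncomputable def eulerProd : ℚ⟦X⟧ := ∏' i : ℕ, (1 - X ^ (i + 1))

theorem hasProd_eulerProd : HasProd (fun i : ℕ ↦ (1 - X ^ (i + 1) : ℚ⟦X⟧)) eulerProd :=
  (multipliable_one_sub_X_pow ℚ).hasProd

theorem eulerProd_ne_zero : eulerProd ≠ 0 := tprod_one_sub_X_pow_ne_zero ℚ

theorem hasProd_expand_eulerProd {k : ℕ} (hk : k ≠ 0) :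
    HasProd (fun i : ℕ ↦ (1 - X ^ (k * (i + 1)) : ℚ⟦X⟧)) (expand k hk eulerProd) := by
  convert! hasProd_eulerProd.map (expand k hk : ℚ⟦X⟧ →ₐ[ℚ] ℚ⟦X⟧) (continuous_expand hk) using 1
  ext1 i
  simp [pow_mul]

theorem expand_eulerProd_ne_zero {k : ℕ} (hk : k ≠ 0) : expand k hk eulerProd ≠ 0 := by
  intro h
  apply eulerProd_ne_zero
  ext n
  rw [← coeff_expand_mul k hk, h]
  simp

theorem hasProd_ite_dvd {k r l : ℕ} (hk : k ≠ 0) (hl : l ≠ 0) (h : l = r * k) :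
    HasProd (fun i : ℕ ↦ if k ∣ i + 1 then (1 - X ^ (r * (i + 1)) : ℚ⟦X⟧) else 1)
      (expand l hl eulerProd) := by
  have hinj : Function.Injective fun i : ℕ ↦ k * (i + 1) - 1 := by
    intro a b hab
    have ha := Nat.mul_pos (Nat.pos_of_ne_zero hk) a.succ_pos
    have hb := Nat.mul_pos (Nat.pos_of_ne_zero hk) b.succ_pos
    have : k * (a + 1) = k * (b + 1) := by simp only at hab; grind
    simpa [hk] using this
  rw [← hinj.hasProd_iff]
  · convert! hasProd_expand_eulerProd hl using 1
    ext1 i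
    have ha := Nat.mul_pos (Nat.pos_of_ne_zero hk) i.succ_pos
    have : k * (i + 1) - 1 + 1 = k * (i + 1) := by grind
    simp [this, h, mul_assoc]
  · intro i hi
    rw [if_neg]
    rintro ⟨m, hm⟩
    refine hi ⟨m - 1, ?_⟩
    have : m ≠ 0 := by rintro rfl; simp at hm
    have : m - 1 + 1 = m := by omega
    simp [this, ← hm]

theorem one_add_tsum_mul_one_sub (f : ℚ⟦X⟧) (hf : constantCoeff f = 0) :
    (1 + ∑' j : ℕ, f ^ (j + 1)) * (1 - f) = 1 := by
  have hs : Summable fun j : ℕ ↦ f ^ (j + 1) := by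
    simp_rw [pow_succ]
    exact (summable_pow_of_constantCoeff_eq_zero hf).mul_right _
  have h := one_sub_mul_tsum_pow_of_constantCoeff_eq_zero hf
  rwa [tsum_eq_zero_add' hs, mul_comm, pow_zero] at h

theorem genFun_regular_factor (p : ℕ → Prop) [DecidablePred p] (i : ℕ) :
    (1 + ∑' j, (if p (i + 1) then (1 : ℚ) else 0) • X ^ ((i + 1) * (j + 1)) : ℚ⟦X⟧) *
      (if p (i + 1) then 1 - X ^ (i + 1) else 1) = 1 := by
  split_ifs
  · simpa [pow_mul] using one_add_tsum_mul_one_sub (X ^ (i + 1)) (by simp)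
  · simp

theorem genFun_distinct_factor (p : ℕ → Prop) [DecidablePred p] (i : ℕ) :
    (1 + ∑' j, (if p (i + 1) ∧ j + 1 = 1 then (1 : ℚ) else 0) • X ^ ((i + 1) * (j + 1)) : ℚ⟦X⟧) =
      if p (i + 1) then 1 + X ^ (i + 1) else 1 := by
  rw [tsum_eq_single 0 (by intro j hj; simp [hj])]
  split_ifs <;> simp_all

theorem genFun_mul_eulerProd :
    Nat.Partition.genFun (fun i _ ↦ if ¬ 3 ∣ i ∧ ¬ 5 ∣ i then (1 : ℚ) else 0) *
      Nat.Partition.genFun (fun i c ↦ if 3 ∣ i ∧ c = 1 then (1 : ℚ) else 0) *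
      Nat.Partition.genFun (fun i c ↦ if 5 ∣ i ∧ c = 1 then (1 : ℚ) else 0) *
      (eulerProd * expand 15 (by simp) eulerProd) =
    expand 6 (by simp) eulerProd * expand 10 (by simp) eulerProd := by
  have h := ((((Nat.Partition.hasProd_genFun
      (fun i _ ↦ if ¬ 3 ∣ i ∧ ¬ 5 ∣ i then (1 : ℚ) else 0)).mul
    (Nat.Partition.hasProd_genFun (fun i c ↦ if 3 ∣ i ∧ c = 1 then (1 : ℚ) else 0))).mul
    (Nat.Partition.hasProd_genFun (fun i c ↦ if 5 ∣ i ∧ c = 1 then (1 : ℚ) else 0))).mul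
    (hasProd_eulerProd.mul
      (hasProd_ite_dvd (k := 15) (r := 1) (l := 15) (by simp) (by simp) (by simp))))
  refine h.unique ?_
  convert! (hasProd_ite_dvd (k := 3) (r := 2) (l := 6) (by simp) (by simp) (by simp)).mul
    (hasProd_ite_dvd (k := 5) (r := 2) (l := 10) (by simp) (by simp) (by simp)) using 1
  ext1 i
  have h1 := genFun_regular_factor (fun i ↦ ¬ 3 ∣ i ∧ ¬ 5 ∣ i) i
  rw [genFun_distinct_factor (fun i ↦ 3 ∣ i), genFun_distinct_factor (fun i ↦ 5 ∣ i)]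
  have h15 : 15 ∣ i + 1 ↔ 3 ∣ i + 1 ∧ 5 ∣ i + 1 := by omega
  simp only [h15]
  have hX : (X ^ (2 * (i + 1)) : ℚ⟦X⟧) = X ^ (i + 1) * X ^ (i + 1) := by ring
  rw [hX]
  clear h hX
  by_cases h3 : 3 ∣ i + 1 <;> by_cases h5 : 5 ∣ i + 1 <;>
    simp only [h3, h5, not_true, not_false_iff, and_true, and_false, and_self, if_true,
      if_false, one_mul, mul_one] at h1 ⊢ <;> rw [h1] <;> ring

theorem one_sub_X_pow_mul_inv (m : ℕ) :
    (1 - X ^ (m + 1) : ℚ⟦X⟧) * (1 - X ^ (m + 1))⁻¹ = 1 :=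
  PowerSeries.mul_inv_cancel _ (by simp)

/-- The product of `(1 - X ^ (2 * k + 2)) / (1 - X ^ (2 * k + 1))` over `s ≤ k < n`. -/
noncomputable def evenOddRatio (n s : ℕ) : ℚ⟦X⟧ :=
  ∏ k ∈ Ico s n, (1 - X ^ (2 * k + 2)) * (1 - X ^ (2 * k + 1))⁻¹

theorem evenOddRatio_self (n : ℕ) : evenOddRatio n n = 1 := by simp [evenOddRatio]

theorem evenOddRatio_succ_left {n s : ℕ} (h : s ≤ n) :
    evenOddRatio (n + 1) s =
      evenOddRatio n s * ((1 - X ^ (2 * n + 2)) * (1 - X ^ (2 * n + 1))⁻¹) := by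
  rw [evenOddRatio, prod_Ico_succ_top h, evenOddRatio]

theorem evenOddRatio_eq_mul {n s : ℕ} (h : s < n) :
    evenOddRatio n s =
      (1 - X ^ (2 * s + 2)) * (1 - X ^ (2 * s + 1))⁻¹ * evenOddRatio n (s + 1) := by
  rw [evenOddRatio, prod_eq_prod_Ico_succ_bot h, evenOddRatio]

theorem sum_evenOddRatio_telescope {n m : ℕ} (h : m ≤ n) :
    ∑ s ∈ range m, (evenOddRatio (n + 1) s * X ^ (s * (2 * n + 3)) -
        evenOddRatio n s * X ^ (s * (2 * n + 1))) =
      evenOddRatio n m * X ^ (m * (2 * n + 1)) * (1 - X ^ (2 * m)) * (1 - X ^ (2 * n + 1))⁻¹ := by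
  induction m with
  | zero => simp
  | succ m ih =>
    rw [sum_range_succ, ih (by omega), evenOddRatio_succ_left (by omega),
      evenOddRatio_eq_mul (by omega : m < n)]
    have h1 := one_sub_X_pow_mul_inv (2 * m)
    have h2 := one_sub_X_pow_mul_inv (2 * n)
    have e1 : (X ^ (m * (2 * n + 3)) : ℚ⟦X⟧) = X ^ (m * (2 * n + 1)) * X ^ (2 * m) := by ring
    have e2 : (X ^ ((m + 1) * (2 * n + 1)) : ℚ⟦X⟧) =
      X ^ (m * (2 * n + 1)) * X ^ (2 * n + 1) := by ring
    have e3 : (X ^ (2 * n + 2) : ℚ⟦X⟧) = X ^ (2 * n + 1) * X := by ring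
    have e4 : (X ^ (2 * m + 1) : ℚ⟦X⟧) = X ^ (2 * m) * X := by ring
    have e5 : (X ^ (2 * (m + 1)) : ℚ⟦X⟧) = X ^ (2 * m + 2) := by ring
    rw [e4] at h1
    rw [e1, e2, e3, e4, e5]
    generalize (1 - X ^ (2 * m) * X : ℚ⟦X⟧)⁻¹ = u at *
    generalize (1 - X ^ (2 * n + 1) : ℚ⟦X⟧)⁻¹ = v at *
    generalize (X ^ (m * (2 * n + 1)) : ℚ⟦X⟧) = y at *
    generalize (X ^ (2 * n + 1) : ℚ⟦X⟧) = q at *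
    generalize (X ^ (2 * m + 2) : ℚ⟦X⟧) = t at *
    generalize (X ^ (2 * m) : ℚ⟦X⟧) = p at *
    linear_combination (evenOddRatio n (m + 1) * (1 - t) * y) * (u * h2 + q * v * h1)

theorem sum_X_pow_triangle (n : ℕ) :
    ∑ i ∈ range (2 * n), (X ^ (i * (i + 1) / 2) : ℚ⟦X⟧) =
      ∑ s ∈ range n, evenOddRatio n s * X ^ (s * (2 * n + 1)) := by
  induction n with
  | zero => simp
  | succ n ih =>
    have ht := sum_evenOddRatio_telescope (le_refl n)
    rw [sum_sub_distrib, sub_eq_iff_eq_add, evenOddRatio_self] at ht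
    rw [mul_add, mul_one, sum_range_succ, sum_range_succ, ih, sum_range_succ,
      show 2 * n + 2 + 1 = 2 * n + 3 by ring, ht, evenOddRatio_succ_left le_rfl,
      evenOddRatio_self]
    have h2 := one_sub_X_pow_mul_inv (2 * n)
    have d1 : 2 * n * (2 * n + 1) / 2 = n * (2 * n + 1) := by
      rw [mul_assoc, Nat.mul_div_cancel_left _ two_pos]
    have d2 : (2 * n + 1) * (2 * n + 1 + 1) / 2 = n * (2 * n + 1) + (2 * n + 1) := by
      rw [show (2 * n + 1) * (2 * n + 1 + 1) = 2 * (n * (2 * n + 1) + (2 * n + 1)) by ring,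
        Nat.mul_div_cancel_left _ two_pos]
    have e1 : (X ^ (n * (2 * n + 3)) : ℚ⟦X⟧) = X ^ (n * (2 * n + 1)) * X ^ (2 * n) := by ring
    have e3 : (X ^ (2 * n + 2) : ℚ⟦X⟧) = X ^ (2 * n + 1) * X := by ring
    have e4 : (X ^ (2 * n + 1) : ℚ⟦X⟧) = X ^ (2 * n) * X := by ring
    rw [d1, d2, e1, e3, pow_add]
    rw [e4] at h2 ⊢
    generalize (1 - X ^ (2 * n) * X : ℚ⟦X⟧)⁻¹ = v at *
    generalize (X ^ (n * (2 * n + 1)) : ℚ⟦X⟧) = y at *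
    generalize (X ^ (2 * n) : ℚ⟦X⟧) = q at *
    linear_combination (-(y * (1 + q * X))) * h2

theorem coeff_sum_X_pow {w : ℕ → ℕ} (hw : ∀ i, i ≤ w i) {d N : ℕ} (h : d < N) :
    coeff d (∑ i ∈ range N, (X ^ w i : ℚ⟦X⟧)) = coeff d (weightSeries w) := by
  simp only [map_sum, coeff_X_pow, weightSeries, coeff_mk, sum_boole]
  rw [Nat.subtype_card]
  intro i
  have := hw i
  simp only [mem_filter, mem_range]
  omega

/-- The generating function of the triangular numbers. -/
noncomputable def triangleSeries : ℚ⟦X⟧ := weightSeries fun i ↦ i * (i + 1) / 2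

theorem le_triangle (i : ℕ) : i ≤ i * (i + 1) / 2 := by
  rw [Nat.le_div_iff_mul_le two_pos]
  rcases i with _ | i
  · simp
  · exact Nat.mul_le_mul_left _ (by omega)

theorem evenOddRatio_zero_mul (n : ℕ) :
    evenOddRatio n 0 * ∏ k ∈ range n, (1 - X ^ (2 * k + 1)) =
      ∏ k ∈ range n, (1 - X ^ (2 * (k + 1))) := by
  rw [evenOddRatio, ← range_eq_Ico, ← prod_mul_distrib]
  refine prod_congr rfl fun k _ ↦ ?_
  rw [mul_assoc, mul_comm _⁻¹, one_sub_X_pow_mul_inv, mul_one, mul_add, mul_one]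

theorem prod_odd_mul_prod_even (n : ℕ) :
    (∏ k ∈ range n, (1 - X ^ (2 * k + 1))) * ∏ k ∈ range n, (1 - X ^ (2 * (k + 1))) =
      ∏ k ∈ range (2 * n), (1 - X ^ (k + 1) : ℚ⟦X⟧) := by
  induction n with
  | zero => simp
  | succ n ih =>
    rw [prod_range_succ, prod_range_succ, mul_add 2 n 1, mul_one, prod_range_succ,
      prod_range_succ, ← ih]
    ring

/-- Gauss's product formula for the generating function of the triangular numbers. -/
theorem triangleSeries_mul_eulerProd :
    triangleSeries * eulerProd = expand 2 two_ne_zero eulerProd ^ 2 := by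
  have hdouble : Tendsto (fun n : ℕ ↦ 2 * n) atTop atTop :=
    tendsto_id.const_mul_atTop' two_pos
  have hsum : Tendsto (fun n ↦ ∑ i ∈ range (2 * n), (X ^ (i * (i + 1) / 2) : ℚ⟦X⟧)) atTop
      (nhds triangleSeries) := by
    rw [tendsto_iff_coeff_tendsto]
    intro d
    refine tendsto_atTop_of_eventually_const (i₀ := d + 1) fun n hn ↦ ?_
    exact coeff_sum_X_pow le_triangle (by omega)
  have heven := (hasProd_expand_eulerProd two_ne_zero).tendsto_prod_nat
  have hlim := (hsum.mul (hasProd_eulerProd.tendsto_prod_nat.comp hdouble)).sub (heven.pow 2)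
  rw [← sub_eq_zero]
  refine tendsto_nhds_unique hlim ?_
  rw [tendsto_iff_coeff_tendsto]
  intro d
  refine tendsto_atTop_of_eventually_const (i₀ := d + 1) fun n hn ↦ ?_
  obtain ⟨n, rfl⟩ : ∃ m, n = m + 1 := ⟨n - 1, by omega⟩
  rw [map_zero]
  refine X_pow_dvd_iff.mp (?_ : X ^ (d + 1) ∣ _) d (by omega)
  simp only [Function.comp_apply]
  rw [sum_X_pow_triangle, ← prod_odd_mul_prod_even, sum_range_succ', ← evenOddRatio_zero_mul,
    zero_mul, pow_zero, mul_one, add_mul]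
  rw [show ∀ a r o : ℚ⟦X⟧, a * (o * (r * o)) + r * (o * (r * o)) - (r * o) ^ 2 =
    a * (o * (r * o)) from fun _ _ _ ↦ by ring]
  refine Dvd.dvd.mul_right (dvd_sum fun s _ ↦ Dvd.dvd.mul_left (pow_dvd_pow _ ?_) _) _
  nlinarith

/-- The triangular numbers indexed, without repetition, by the integers. -/
def intTriangle (k : ℤ) : ℕ := (k * (2 * k + 1)).natAbs

theorem natCast_intTriangle (k : ℤ) : (intTriangle k : ℤ) = k * (2 * k + 1) := by
  rw [intTriangle, Int.natCast_natAbs, abs_of_nonneg]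
  rcases lt_or_ge k 0 with h | h <;> nlinarith

theorem triangleSeries_eq : triangleSeries = weightSeries intTriangle := by
  rw [triangleSeries, ← weightSeries_comp_equiv Equiv.intEquivNat]
  congr 1
  ext k
  zify
  rw [natCast_intTriangle]
  refine Int.ediv_eq_of_eq_mul_right two_ne_zero ?_
  rcases k with k | k
  · have h : Equiv.intEquivNat (Int.ofNat k) = 2 * k := Nat.bit_false_apply k
    rw [h, Int.ofNat_eq_natCast]
    push_cast
    ring
  · have h : Equiv.intEquivNat (Int.negSucc k) = 2 * k + 1 := Nat.bit_true_apply k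
    rw [h, Int.negSucc_eq]
    push_cast
    ring

theorem finite_intTriangle_fiber (n : ℕ) : Finite {k // intTriangle k = n} := by
  refine ((Set.finite_Icc (-n : ℤ) n).subset ?_ : {k | intTriangle k = n}.Finite)
  rintro k rfl
  rw [Set.mem_Icc, natCast_intTriangle]
  constructor <;> rcases lt_or_ge k 0 with h | h <;> nlinarith

theorem even_add_of_triangle_form {a b : ℤ} {n : ℕ}
    (h : intTriangle a + 15 * intTriangle b = 2 * n) : (a + b) % 2 = 0 := by
  zify at h
  simp only [natCast_intTriangle] at h
  have : a + b = 2 * (n - a * a - 15 * (b * b) - 7 * b) := by linear_combination h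
  omega

/-- The solutions of `T a + 15 * T b = 2 * n` in triangular numbers correspond to those of
`6 * T c + 10 * T d = 2 * n`. -/
def triangleFormEquiv (n : ℕ) :
    {p : ℤ × ℤ // 6 * intTriangle p.1 + 10 * intTriangle p.2 = 2 * n} ≃
      {p : ℤ × ℤ // intTriangle p.1 + 15 * intTriangle p.2 = 2 * n} where
  toFun p := ⟨if (p.1.1 + p.1.2) % 2 = 0
    then ((5 * p.1.2 - 3 * p.1.1) / 2, (p.1.1 + p.1.2) / 2)
    else ((3 * p.1.1 - 5 * p.1.2 - 1) / 2, -((p.1.1 + p.1.2 + 1) / 2)), by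
      obtain ⟨⟨c, d⟩, h⟩ := p
      zify at h ⊢
      simp only [natCast_intTriangle] at h ⊢
      split_ifs with hcd
      · obtain ⟨b, rfl⟩ : ∃ b, c = 2 * b - d := ⟨(c + d) / 2, by omega⟩
        rw [show (5 * d - 3 * (2 * b - d)) / 2 = 4 * d - 3 * b by omega,
          show (2 * b - d + d) / 2 = b by omega]
        linear_combination h
      · obtain ⟨b, rfl⟩ : ∃ b, c = -2 * b - 1 - d := ⟨-((c + d + 1) / 2), by omega⟩
        rw [show (3 * (-2 * b - 1 - d) - 5 * d - 1) / 2 = -4 * d - 3 * b - 2 by omega,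
          show -((-2 * b - 1 - d + d + 1) / 2) = b by omega]
        linear_combination h⟩
  invFun p := ⟨if (p.1.1 + 3 * p.1.2) % 4 = 0
    then ((5 * p.1.2 - p.1.1) / 4, (p.1.1 + 3 * p.1.2) / 4)
    else ((p.1.1 - 5 * p.1.2 - 2) / 4, -((p.1.1 + 3 * p.1.2 + 2) / 4)), by
      obtain ⟨⟨a, b⟩, h⟩ := p
      have hab := even_add_of_triangle_form h
      zify at h ⊢
      simp only [natCast_intTriangle] at h ⊢
      split_ifs with hcd
      · obtain ⟨d, rfl⟩ : ∃ d, a = 4 * d - 3 * b := ⟨(a + 3 * b) / 4, by omega⟩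
        rw [show (5 * b - (4 * d - 3 * b)) / 4 = 2 * b - d by omega,
          show (4 * d - 3 * b + 3 * b) / 4 = d by omega]
        linear_combination h
      · obtain ⟨d, rfl⟩ : ∃ d, a = -4 * d - 3 * b - 2 := ⟨-((a + 3 * b + 2) / 4), by omega⟩
        rw [show (-4 * d - 3 * b - 2 - 5 * b - 2) / 4 = -2 * b - 1 - d by omega,
          show -((-4 * d - 3 * b - 2 + 3 * b + 2) / 4) = d by omega]
        linear_combination h⟩
  left_inv := by
    rintro ⟨⟨c, d⟩, h⟩
    refine Subtype.ext (Prod.ext ?_ ?_) <;> dsimp only <;> split_ifs <;> dsimp only at * <;> omega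
  right_inv := by
    rintro ⟨⟨a, b⟩, h⟩
    have hab := even_add_of_triangle_form h
    refine Subtype.ext (Prod.ext ?_ ?_) <;> dsimp only <;> split_ifs <;> dsimp only at * <;> omega

theorem rescale_neg_one_expand {k : ℕ} (hk : k ≠ 0) (h : Even k) (f : ℚ⟦X⟧) :
    rescale (-1) (expand k hk f) = expand k hk f := by
  ext n
  rw [coeff_rescale, coeff_expand]
  split_ifs with hd
  · rw [(h.trans_dvd hd).neg_one_pow, one_mul]
  · simp

/-- Ramanujan's identity for the even part of `ψ(q) ψ(q ^ 15)`. -/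
theorem triangleSeries_even_part :
    triangleSeries * expand 15 (by simp) triangleSeries +
        rescale (-1) (triangleSeries * expand 15 (by simp) triangleSeries) =
      2 * (expand 6 (by simp) triangleSeries * expand 10 (by simp) triangleSeries) := by
  have hfin := finite_intTriangle_fiber
  rw [triangleSeries_eq]
  simp only [expand_weightSeries]
  rw [weightSeries_mul _ _ hfin (finite_mul_fiber (by simp) _ hfin),
    weightSeries_mul _ _ (finite_mul_fiber (by simp) _ hfin) (finite_mul_fiber (by simp) _ hfin)]
  ext n
  rw [two_mul, map_add, map_add, coeff_rescale]
  simp only [weightSeries, coeff_mk]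
  rcases n.even_or_odd' with ⟨n, rfl | rfl⟩
  · rw [Nat.card_congr (triangleFormEquiv n)]
    simp
  · have : IsEmpty {p : ℤ × ℤ // 6 * intTriangle p.1 + 10 * intTriangle p.2 = 2 * n + 1} :=
      ⟨fun p ↦ by have := p.2; omega⟩
    simp [pow_succ]

theorem even_part_of_mul_eulerProd {f : ℚ⟦X⟧}
    (hf : f * (eulerProd * expand 15 (by simp) eulerProd) =
      expand 6 (by simp) eulerProd * expand 10 (by simp) eulerProd) :
    f + rescale (-1) f = 2 * expand 2 two_ne_zero f ^ 2 := by
  have hg := triangleSeries_mul_eulerProd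
  have h2 := congrArg (expand 2 two_ne_zero) hf
  have h6 := congrArg (expand 6 (by simp)) hg
  have h10 := congrArg (expand 10 (by simp)) hg
  have h15 := congrArg (expand 15 (by simp)) hg
  simp only [map_mul, map_pow, ← expand_mul, Nat.reduceMul] at h2 h6 h10 h15
  have hpos : f * (expand 2 two_ne_zero eulerProd ^ 2 * expand 30 (by simp) eulerProd ^ 2) =
      expand 6 (by simp) eulerProd * expand 10 (by simp) eulerProd *
        (triangleSeries * expand 15 (by simp) triangleSeries) := by
    rw [← hg, ← h15, ← hf]
    ring
  have hneg := congrArg (rescale (-1)) hpos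
  simp only [map_mul (rescale (-1 : ℚ)) _ _, map_pow (rescale (-1 : ℚ)) _ _] at hneg
  rw [← map_mul (rescale (-1 : ℚ)) triangleSeries] at hneg
  rw [rescale_neg_one_expand _ (by decide), rescale_neg_one_expand _ (by decide),
    rescale_neg_one_expand _ (by decide), rescale_neg_one_expand _ (by decide)] at hneg
  have h0 : expand 2 two_ne_zero eulerProd ^ 2 * expand 30 (by simp) eulerProd ^ 2 ≠ 0 :=
    mul_ne_zero (pow_ne_zero _ (expand_eulerProd_ne_zero _))
      (pow_ne_zero _ (expand_eulerProd_ne_zero _))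
  refine mul_right_cancel₀ h0 ?_
  rw [add_mul, hpos, hneg, ← mul_add, triangleSeries_even_part,
    show ∀ a b c d : ℚ⟦X⟧, a * b * (2 * (c * d)) = 2 * ((c * a) * (d * b)) from
      fun _ _ _ _ ↦ by ring, h6, h10,
    show ∀ a b c : ℚ⟦X⟧, 2 * a ^ 2 * (b ^ 2 * c ^ 2) = 2 * (a * (b * c)) ^ 2 from
      fun _ _ _ ↦ by ring, h2]
  ring

/-- If `c n` is the number of triples `(λ, μ, ν)` where `λ` is a partition with no part
divisible by `3` and no part divisible by `5`, `μ` is a partition into distinct parts all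
divisible by `3`, `ν` is a partition into distinct parts all divisible by `5`, and
`|λ| + |μ| + |ν| = n` (OEIS A094023), then `c` is `2`-convolutive:
`c (2n) = ∑_{i=0}^{n} c i * c (n - i)`. -/
theorem A094023_two_convolutive (c : ℕ → ℕ)
    (hc : ∀ n, c n = Nat.card {t : Multiset ℕ × Multiset ℕ × Multiset ℕ //
      (∀ i ∈ t.1, 0 < i ∧ ¬ 3 ∣ i ∧ ¬ 5 ∣ i) ∧
      (∀ i ∈ t.2.1, 0 < i ∧ 3 ∣ i) ∧ t.2.1.Nodup ∧
      (∀ i ∈ t.2.2, 0 < i ∧ 5 ∣ i) ∧ t.2.2.Nodup ∧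
      t.1.sum + t.2.1.sum + t.2.2.sum = n}) :
    ∀ n, c (2 * n) = ∑ i ∈ Finset.range (n + 1), c i * c (n - i) := by
  have hfin (Q : ℕ → ℕ → Prop) (n : ℕ) :
      Finite {m : {m : Multiset ℕ // ∀ i ∈ m, 0 < i ∧ Q i (m.count i)} // m.1.sum = n} :=
    finite_multiset_fiber _ (fun m hm i hi ↦ (hm i hi).1) n
  have hdistinct (k : ℕ) (m : Multiset ℕ) :
      (∀ i ∈ m, 0 < i ∧ k ∣ i ∧ m.count i = 1) ↔ (∀ i ∈ m, 0 < i ∧ k ∣ i) ∧ m.Nodup := by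
    constructor
    · refine fun h ↦ ⟨fun i hi ↦ ⟨(h i hi).1, (h i hi).2.1⟩, ?_⟩
      rw [Multiset.nodup_iff_count_le_one]
      intro i
      by_cases hi : i ∈ m
      · exact (h i hi).2.2.le
      · simp [Multiset.count_eq_zero_of_notMem hi]
    · exact fun h i hi ↦
        ⟨(h.1 i hi).1, (h.1 i hi).2, Multiset.count_eq_one_of_mem h.2 hi⟩
  have hseries : PowerSeries.mk (fun n ↦ (c n : ℚ)) =
      Nat.Partition.genFun (fun i _ ↦ if ¬ 3 ∣ i ∧ ¬ 5 ∣ i then (1 : ℚ) else 0) *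
      Nat.Partition.genFun (fun i c ↦ if 3 ∣ i ∧ c = 1 then (1 : ℚ) else 0) *
      Nat.Partition.genFun (fun i c ↦ if 5 ∣ i ∧ c = 1 then (1 : ℚ) else 0) := by
    rw [← weightSeries_multiset (fun i _ ↦ ¬ 3 ∣ i ∧ ¬ 5 ∣ i),
      ← weightSeries_multiset (fun i c ↦ 3 ∣ i ∧ c = 1),
      ← weightSeries_multiset (fun i c ↦ 5 ∣ i ∧ c = 1),
      weightSeries_mul _ _ (hfin (fun i _ ↦ ¬ 3 ∣ i ∧ ¬ 5 ∣ i)) (hfin (fun i c ↦ 3 ∣ i ∧ c = 1)),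
      weightSeries_mul _ _ (finite_add_fiber _ _ (hfin (fun i _ ↦ ¬ 3 ∣ i ∧ ¬ 5 ∣ i))
        (hfin (fun i c ↦ 3 ∣ i ∧ c = 1))) (hfin (fun i c ↦ 5 ∣ i ∧ c = 1))]
    ext n
    simp only [weightSeries, coeff_mk, hc]
    refine congrArg _ (Nat.card_congr ?_)
    exact
      { toFun := fun t ↦ ⟨((⟨t.1.1, t.2.1⟩, ⟨t.1.2.1, (hdistinct 3 _).2 ⟨t.2.2.1, t.2.2.2.1⟩⟩),
          ⟨t.1.2.2, (hdistinct 5 _).2 ⟨t.2.2.2.2.1, t.2.2.2.2.2.1⟩⟩), t.2.2.2.2.2.2⟩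
        invFun := fun p ↦ ⟨(p.1.1.1.1, p.1.1.2.1, p.1.2.1), p.1.1.1.2,
          ((hdistinct 3 _).1 p.1.1.2.2).1, ((hdistinct 3 _).1 p.1.1.2.2).2,
          ((hdistinct 5 _).1 p.1.2.2).1, ((hdistinct 5 _).1 p.1.2.2).2, p.2⟩
        left_inv := fun _ ↦ rfl
        right_inv := fun _ ↦ rfl }
  have heven := even_part_of_mul_eulerProd (hseries ▸ genFun_mul_eulerProd)
  intro n
  have h := congrArg (coeff (2 * n)) heven
  rw [two_mul (_ ^ 2 : ℚ⟦X⟧), ← map_pow, map_add, map_add, coeff_rescale, coeff_expand_mul, sq,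
    coeff_mul, Nat.sum_antidiagonal_eq_sum_range_succ_mk] at h
  simp only [coeff_mk, pow_mul, neg_one_sq, one_pow, one_mul] at h
  have h' : (c (2 * n) : ℚ) = ∑ i ∈ Finset.range (n + 1), (c i : ℚ) * c (n - i) := by linarith
  exact_mod_cast h'
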